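/- arXiv:2309.13717 — 8 statements merged into one kernel-verified Lean document; each statement's English description precedes it below -/
import Mathlib

section
/- Let R be a curvature-like tensor on ℝ⁴ whose curvature-operator matrix M(R) commutes with J := Matrix.fromBlocks 0 1 (−1) 0 (3×3 blocks). Define Ric(R) j k := Σ_{i : Fin 4} R i j k i. Then Ric(R) j k = 0 for all distinct j, k ∈ {2,3,4}, and Ric(R) 1 1 = Ric(R) 2 2 = Ric(R) 3 3 = Ric(R) 4 4. That is, Ric(R) has the almost-Einstein form [[λ,ψ₁,ψ₂,ψ₃],[ψ₁,λ,0,0],[ψ₂,0,λ,0],[ψ₃,0,0,λ]] with λ := Ric(R) 1 1 and ψᵢ := Ric(R) 1 (i+1). -/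
open Matrix

/-- The two diagonal blocks of a matrix commuting with `fromBlocks 0 1 (-1) 0` agree. -/
theorem apply_castAdd_eq_apply_natAdd_of_commute {n : ℕ} {α : Type*} [Ring α]
    (M : Matrix (Fin (n + n)) (Fin (n + n)) α)
    (h : M * (Matrix.fromBlocks (0 : Matrix (Fin n) (Fin n) α) 1 (-1) 0).submatrix
        finSumFinEquiv.symm finSumFinEquiv.symm =
      (Matrix.fromBlocks (0 : Matrix (Fin n) (Fin n) α) 1 (-1) 0).submatrix
        finSumFinEquiv.symm finSumFinEquiv.symm * M) (p q : Fin n) :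
    M (Fin.castAdd n p) (Fin.castAdd n q) = M (Fin.natAdd n p) (Fin.natAdd n q) := by
  have hpq := congrFun (congrFun h (Fin.castAdd n p)) (Fin.natAdd n q)
  simpa [Matrix.mul_apply, Fin.sum_univ_add, Matrix.one_apply, -Fin.natAdd_eq_addNat] using hpq

/-- Theorem 3.3 (prop:psE), almost-Einstein conclusion: if the curvature-operator matrix of a
curvature-like tensor `R` on ℝ⁴ commutes with the Lorentzian Hodge star
`J = fromBlocks 0 1 (-1) 0` (in the bivector basis e₁∧e₂, e₁∧e₃, e₁∧e₄, e₃∧e₄, e₄∧e₂, e₂∧e₃),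
then its Ricci tensor `Ric j k = ∑ i, R i j k i` vanishes for distinct `j k` not equal to the
first index, and all its diagonal entries agree. -/
theorem stmt_3
    (R : Fin 4 → Fin 4 → Fin 4 → Fin 4 → ℝ)
    (hR1 : ∀ a b c d, R a b c d = -R b a c d)
    (hR2 : ∀ a b c d, R a b c d = -R a b d c)
    (hR3 : ∀ a b c d, R a b c d = R c d a b)
    (pairs : Fin 6 → Fin 4 × Fin 4)
    (hpairs : pairs = ![(0,1), (0,2), (0,3), (2,3), (3,1), (1,2)])
    (MR : Matrix (Fin 6) (Fin 6) ℝ)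
    (hMR : ∀ p q, MR p q = -R (pairs p).1 (pairs p).2 (pairs q).1 (pairs q).2)
    (J : Matrix (Fin 6) (Fin 6) ℝ)
    (hJ : J = (Matrix.fromBlocks (0 : Matrix (Fin 3) (Fin 3) ℝ) 1 (-1) 0).submatrix
      (@finSumFinEquiv 3 3).symm (@finSumFinEquiv 3 3).symm)
    (hcomm : MR * J = J * MR)
    (Ric : Fin 4 → Fin 4 → ℝ)
    (hRic : ∀ j k, Ric j k = ∑ i, R i j k i) :
    (∀ j k : Fin 4, j ≠ k → j ≠ 0 → k ≠ 0 → Ric j k = 0) ∧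
    Ric 0 0 = Ric 1 1 ∧ Ric 1 1 = Ric 2 2 ∧ Ric 2 2 = Ric 3 3 := by
  subst hJ
  have block_eq := apply_castAdd_eq_apply_natAdd_of_commute (n := 3) MR hcomm
  have h00 := block_eq 0 0
  have h11 := block_eq 1 1
  have h22 := block_eq 2 2
  have h01 := block_eq 0 1
  have h02 := block_eq 0 2
  have h12 := block_eq 1 2
  simp only [hMR, hpairs] at h00 h11 h22 h01 h02 h12
  simp [Fin.natAdd, Fin.castAdd, Fin.castLE] at h00 h11 h22 h01 h02 h12
  have diag_left : ∀ a c d, R a a c d = 0 := fun a c d => by linarith [hR1 a a c d]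
  have diag_right : ∀ a b c, R a b c c = 0 := fun a b c => by linarith [hR2 a b c c]
  refine ⟨fun j k hjk hj hk => ?_, ?_, ?_, ?_⟩
  · rw [hRic, Fin.sum_univ_four]
    fin_cases j <;> fin_cases k <;> simp [diag_left, diag_right] at hjk hj hk ⊢ <;> grind
  all_goals
    simp only [hRic, Fin.sum_univ_four, diag_left]
    grind
end

section
/- Let J := Matrix.fromBlocks 0 1 (−1) 0 and η := Matrix.diagonal ![−1,−1,−1,1,1,1] (6×6 real matrices), and let M be any 6×6 real matrix with M·J = J·M. Then for every x : Fin 6 → ℝ: (i) (J *ᵥ x) ⬝ᵥ (η *ᵥ (J *ᵥ x)) = −(x ⬝ᵥ (η *ᵥ x)); (ii) (J *ᵥ x) ⬝ᵥ (η *ᵥ (M *ᵥ (J *ᵥ x))) = −(x ⬝ᵥ (η *ᵥ (M *ᵥ x))); and consequently (iii) ((J *ᵥ x) ⬝ᵥ (η *ᵥ (J *ᵥ x)))·((J *ᵥ x) ⬝ᵥ (η *ᵥ (M *ᵥ (J *ᵥ x)))) = (x ⬝ᵥ (η *ᵥ x))·(x ⬝ᵥ (η *ᵥ (M *ᵥ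 x))). -/
open Matrix

/-- If `Jᵀ * η * J = -η`, then `J` is an anti-isometry of the bilinear form with matrix `η`. -/
theorem mulVec_dotProduct_mulVec_of_transpose_mul_mul_eq_neg {n R : Type*} [Fintype n]
    [CommRing R] {J η : Matrix n n R} (h : Jᵀ * η * J = -η) (x y : n → R) :
    (J *ᵥ x) ⬝ᵥ (η *ᵥ (J *ᵥ y)) = -(x ⬝ᵥ (η *ᵥ y)) := by
  rw [← dotProduct_neg, ← neg_mulVec, ← h, ← mulVec_mulVec, ← mulVec_mulVec,
    dotProduct_mulVec x, vecMul_transpose]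

/-- Theorem 3.7 (thm:secsec): with `J` the Lorentzian Hodge star and `η` the matrix of the
Lorentzian inner product on Λ², for any `M` commuting with `J` and any bivector `x`:
(i) `⟨Jx, Jx⟩_L = -⟨x,x⟩_L`; (ii) `⟨M(Jx), Jx⟩_L = -⟨Mx, x⟩_L`; hence (iii)
`ε_L(Jx)·⟨M(Jx),Jx⟩_L = ε_L(x)·⟨Mx,x⟩_L`, i.e. `sec_L(P^{⊥_L}) = sec_L(P)`. -/
theorem stmt_7
    (J : Matrix (Fin 6) (Fin 6) ℝ)
    (hJ : J = (Matrix.fromBlocks (0 : Matrix (Fin 3) (Fin 3) ℝ) 1 (-1) 0).submatrix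
      (@finSumFinEquiv 3 3).symm (@finSumFinEquiv 3 3).symm)
    (η : Matrix (Fin 6) (Fin 6) ℝ)
    (hη : η = Matrix.diagonal ![-1, -1, -1, 1, 1, 1])
    (M : Matrix (Fin 6) (Fin 6) ℝ) (hM : M * J = J * M) (x : Fin 6 → ℝ) :
    (J *ᵥ x) ⬝ᵥ (η *ᵥ (J *ᵥ x)) = -(x ⬝ᵥ (η *ᵥ x)) ∧
    (J *ᵥ x) ⬝ᵥ (η *ᵥ (M *ᵥ (J *ᵥ x))) = -(x ⬝ᵥ (η *ᵥ (M *ᵥ x))) ∧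
    ((J *ᵥ x) ⬝ᵥ (η *ᵥ (J *ᵥ x))) * ((J *ᵥ x) ⬝ᵥ (η *ᵥ (M *ᵥ (J *ᵥ x)))) =
      (x ⬝ᵥ (η *ᵥ x)) * (x ⬝ᵥ (η *ᵥ (M *ᵥ x))) := by
  have h : Jᵀ * η * J = -η := by
    have hη' : η = (Matrix.fromBlocks (-1 : Matrix (Fin 3) (Fin 3) ℝ) 0 0 1).submatrix
        (@finSumFinEquiv 3 3).symm (@finSumFinEquiv 3 3).symm := by
      rw [hη, ← diagonal_one, diagonal_neg, fromBlocks_diagonal, submatrix_diagonal_equiv]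
      congr 1
      funext i
      fin_cases i <;> rfl
    rw [hJ, hη', transpose_submatrix, submatrix_mul_equiv, submatrix_mul_equiv,
      fromBlocks_transpose, fromBlocks_multiply, fromBlocks_multiply]
    change _ = (-Matrix.fromBlocks _ _ _ _).submatrix _ _
    simp [fromBlocks_neg]
  have h₁ := mulVec_dotProduct_mulVec_of_transpose_mul_mul_eq_neg h x x
  have h₂ : (J *ᵥ x) ⬝ᵥ (η *ᵥ (M *ᵥ (J *ᵥ x))) = -(x ⬝ᵥ (η *ᵥ (M *ᵥ x))) := by
    rw [mulVec_mulVec x M J, hM, ← mulVec_mulVec]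
    exact mulVec_dotProduct_mulVec_of_transpose_mul_mul_eq_neg h x (M *ᵥ x)
  exact ⟨h₁, h₂, by rw [h₁, h₂, neg_mul_neg]⟩
end

section
/- Let K be any 6×6 real matrix. Define v : ℝ⁴ → (Fin 6 → ℝ) by v(x₁,x₂,x₃,x₄) := ![x₂x₃ − x₁x₄, −x₁, x₃, 1, −x₄, −x₂], Q(x) := 1 − x₁² + x₂² − x₃² + x₄² − (x₂x₃ − x₁x₄)², and F(x) := −(v(x) ⬝ᵥ (K *ᵥ v(x))) / Q(x) (so F is smooth on the neighborhood of 0 where Q > 0, and Q(0) = 1). Then the Fréchet derivative of F at 0 ∈ ℝ⁴ vanishes if and only if K 4 2 + K 2 4 = 0, K 4 3 + K 3 4 = 0, K 4 5 + K 5 4 = 0, and K 4 6 + K 6 4 = 0 (matrix entries written 1-based). -/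
open Matrix

lemma hasDerivAt_neg_quadratic_div (a b c s : ℝ) :
    HasDerivAt (fun t : ℝ => -(a + b * t + c * t ^ 2) / (1 + s * t ^ 2)) (-b) 0 := by
  have hsq : HasDerivAt (fun t : ℝ => t ^ 2) 0 0 := by
    simpa using hasDerivAt_pow 2 (0 : ℝ)
  have hnum := ((((hasDerivAt_id (0 : ℝ)).const_mul b).const_add a).add (hsq.const_mul c)).neg
  have hden := (hsq.const_mul s).const_add 1
  have h := hnum.div hden (by simp)
  refine (h.congr_deriv (by simp)).congr_of_eventuallyEq (Filter.Eventually.of_forall fun t => ?_)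
  simp

/-- If `F` restricts to a quotient of quadratics on the line through `w`, its derivative at `0`
along `w` is read off from the linear coefficient. -/
lemma fderiv_apply_eq_of_quadratic_div {E : Type*} [NormedAddCommGroup E] [NormedSpace ℝ E]
    {F : E → ℝ} (hF : DifferentiableAt ℝ F 0) (w : E) (a b c s : ℝ)
    (h : ∀ t : ℝ, F (t • w) = -(a + b * t + c * t ^ 2) / (1 + s * t ^ 2)) :
    fderiv ℝ F 0 w = -b := by
  rw [← hF.lineDeriv_eq_fderiv, lineDeriv]
  simpa only [zero_add, h] using (hasDerivAt_neg_quadratic_div a b c s).deriv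

/-- Proposition 3.11 (prop:crit), chart computation: with `φ(x) = v(x)/√Q(x)` the chart of the
Grassmannian `G₊` centered at `e₃∧e₄`, and `F = sec_L ∘ φ` the L-sectional curvature of the
operator with `⟨·,·⟩_L`-components `K`, the derivative of `F` at `0` vanishes iff
`K₃₄ᵢⱼ = -Kᵢⱼ₃₄` for `(i,j) ∈ {(1,3),(1,4),(4,2),(2,3)}` (entries of `K` written 0-based). -/
theorem stmt_11 (K : Matrix (Fin 6) (Fin 6) ℝ)
    (v : (Fin 4 → ℝ) → (Fin 6 → ℝ))
    (hv : ∀ x, v x = ![x 1 * x 2 - x 0 * x 3, -x 0, x 2, 1, -x 3, -x 1])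
    (Q : (Fin 4 → ℝ) → ℝ)
    (hQ : ∀ x, Q x =
      1 - x 0 ^ 2 + x 1 ^ 2 - x 2 ^ 2 + x 3 ^ 2 - (x 1 * x 2 - x 0 * x 3) ^ 2)
    (F : (Fin 4 → ℝ) → ℝ)
    (hF : ∀ x, F x = -(v x ⬝ᵥ (K *ᵥ v x)) / Q x) :
    fderiv ℝ F 0 = 0 ↔
      (K 3 1 + K 1 3 = 0 ∧ K 3 2 + K 2 3 = 0 ∧ K 3 4 + K 4 3 = 0 ∧ K 3 5 + K 5 3 = 0) := by
  have hdiff : DifferentiableAt ℝ F 0 := by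
    have hvd : ∀ i, DifferentiableAt ℝ (fun x => v x i) 0 := fun i => by
      simp only [hv]
      fin_cases i <;> simp <;> fun_prop
    have hQd : DifferentiableAt ℝ Q 0 := by
      rw [funext hQ]
      fun_prop
    rw [funext hF]
    simp only [dotProduct, mulVec, div_eq_mul_inv]
    exact DifferentiableAt.fun_mul (by fun_prop) (hQd.fun_inv (by simp [hQ]))
  have h0 : fderiv ℝ F 0 (Pi.single 0 1) = -(-(K 3 1 + K 1 3)) :=
    fderiv_apply_eq_of_quadratic_div hdiff _ (K 3 3) _ (K 1 1) (-1) fun t => by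
      simp [hF, hv, hQ, dotProduct, mulVec, Fin.sum_univ_six]
      ring
  have h1 : fderiv ℝ F 0 (Pi.single 1 1) = -(-(K 3 5 + K 5 3)) :=
    fderiv_apply_eq_of_quadratic_div hdiff _ (K 3 3) _ (K 5 5) 1 fun t => by
      simp [hF, hv, hQ, dotProduct, mulVec, Fin.sum_univ_six]
      ring
  have h2 : fderiv ℝ F 0 (Pi.single 2 1) = -(K 3 2 + K 2 3) :=
    fderiv_apply_eq_of_quadratic_div hdiff _ (K 3 3) _ (K 2 2) (-1) fun t => by
      simp [hF, hv, hQ, dotProduct, mulVec, Fin.sum_univ_six]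
      ring
  have h3 : fderiv ℝ F 0 (Pi.single 3 1) = -(-(K 3 4 + K 4 3)) :=
    fderiv_apply_eq_of_quadratic_div hdiff _ (K 3 3) _ (K 4 4) 1 fun t => by
      simp [hF, hv, hQ, dotProduct, mulVec, Fin.sum_univ_six]
      ring
  constructor
  · intro h
    simp only [h, _root_.zero_apply] at h0 h1 h2 h3
    refine ⟨?_, ?_, ?_, ?_⟩ <;> linarith
  · rintro ⟨k1, k2, k4, k5⟩
    refine ContinuousLinearMap.coe_injective (LinearMap.pi_ext' fun i => LinearMap.ext_ring ?_)
    fin_cases i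
    · simpa [k1] using h0
    · simpa [k5] using h1
    · rw [k2, neg_zero] at h2
      simpa using h2
    · simpa [k4] using h3
end

section
/- Let M be a symmetric 6×6 real matrix, J := Matrix.fromBlocks 0 1 (−1) 0, η := Matrix.diagonal ![−1,−1,−1,1,1,1], and S := (1/2 : ℝ) • (M − J·M·J). Then: (i) S is symmetric and S·J = J·S; (ii) for all x : Fin 6 → ℝ, (J *ᵥ x) ⬝ᵥ (η *ᵥ (S *ᵥ (J *ᵥ x))) = −(x ⬝ᵥ (η *ᵥ (S *ᵥ x))); (iii) if P := Pi.single 3 1 (0-indexed; the bivector e₃∧e₄) satisfies S *ᵥ P = a • P + b • (Pi.single 0 1) for some a b : ℝ, then (η·S) 4 k + (η·S) k 4 = 0 for every k ∈ {2,3,5,6} (entries written 1-based). -/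
open Matrix

/-- Theorem 3.15 (thm:SS): for a symmetric `M` (the curvature operator of `g`), its symmetric
part `S = ½(M - J·M·J)` (i) is symmetric and commutes with the Lorentzian Hodge star `J`,
(ii) satisfies `sec_S(Jx)`-reversal `⟨S(Jx), Jx⟩_L = -⟨Sx, x⟩_L`, and (iii) if the plane
`e₃∧e₄` is a complex eigenvector of `S` (i.e. `S P = a•P + b•(e₁∧e₂)`), then the
critical-point equations `(ηS)₃ₖ + (ηS)ₖ₃ = 0`, `k ∈ {1,2,4,5}` (0-based), hold. -/
theorem stmt_14 (M : Matrix (Fin 6) (Fin 6) ℝ) (hsym : Mᵀ = M)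
    (J : Matrix (Fin 6) (Fin 6) ℝ)
    (hJ : J = (Matrix.fromBlocks (0 : Matrix (Fin 3) (Fin 3) ℝ) 1 (-1) 0).submatrix
      (@finSumFinEquiv 3 3).symm (@finSumFinEquiv 3 3).symm)
    (η : Matrix (Fin 6) (Fin 6) ℝ)
    (hη : η = Matrix.diagonal ![-1, -1, -1, 1, 1, 1])
    (S : Matrix (Fin 6) (Fin 6) ℝ)
    (hS : S = (1 / 2 : ℝ) • (M - J * M * J)) :
    (Sᵀ = S ∧ S * J = J * S) ∧
    (∀ x : Fin 6 → ℝ,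
      (J *ᵥ x) ⬝ᵥ (η *ᵥ (S *ᵥ (J *ᵥ x))) = -(x ⬝ᵥ (η *ᵥ (S *ᵥ x)))) ∧
    (∀ a b : ℝ, S *ᵥ (Pi.single 3 1 : Fin 6 → ℝ) =
        a • (Pi.single 3 1 : Fin 6 → ℝ) + b • (Pi.single 0 1 : Fin 6 → ℝ) →
      ((η * S) 3 1 + (η * S) 1 3 = 0 ∧ (η * S) 3 2 + (η * S) 2 3 = 0 ∧
       (η * S) 3 4 + (η * S) 4 3 = 0 ∧ (η * S) 3 5 + (η * S) 5 3 = 0)) := by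
  have hJt : Jᵀ = -J := by
    rw [hJ, transpose_submatrix, fromBlocks_transpose]
    ext i j
    fin_cases i <;> fin_cases j <;> simp [finSumFinEquiv, Fin.addCases]
  have hJJ : J * J = -1 := by
    rw [hJ, submatrix_mul_equiv, fromBlocks_multiply]
    have hneg : fromBlocks (-1 : Matrix (Fin 3) (Fin 3) ℝ) 0 (0 : Matrix (Fin 3) (Fin 3) ℝ)
        (-1 : Matrix (Fin 3) (Fin 3) ℝ) = -1 := by
      rw [← fromBlocks_one, fromBlocks_neg, neg_zero]
    simp only [mul_zero, zero_mul, mul_one, one_mul, zero_add, add_zero, hneg]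
    change -((1 : Matrix (Fin 3 ⊕ Fin 3) (Fin 3 ⊕ Fin 3) ℝ).submatrix _ _) = -1
    rw [submatrix_one_equiv]
  have hηJ : Jᵀ * η * J = -η := by
    have hηb : η = (fromBlocks (-1 : Matrix (Fin 3) (Fin 3) ℝ) 0 0 1).submatrix
        (@finSumFinEquiv 3 3).symm (@finSumFinEquiv 3 3).symm := by
      rw [hη]
      ext i j
      fin_cases i <;> fin_cases j <;> simp [finSumFinEquiv, Fin.addCases]
    rw [hJ, hηb, transpose_submatrix, fromBlocks_transpose, submatrix_mul_equiv,
      submatrix_mul_equiv, fromBlocks_multiply, fromBlocks_multiply]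
    change _ = (-fromBlocks (-1 : Matrix (Fin 3) (Fin 3) ℝ) 0 0 1).submatrix _ _
    rw [fromBlocks_neg]
    simp
  have hSt : Sᵀ = S := by
    rw [hS, transpose_smul, transpose_sub, transpose_mul, transpose_mul, hsym, hJt]
    simp [Matrix.mul_assoc]
  have hSJ : S * J = J * S := by
    rw [hS, smul_mul, Matrix.mul_smul, sub_mul, mul_sub, Matrix.mul_assoc (J * M), hJJ,
      Matrix.mul_assoc J M J, ← Matrix.mul_assoc J J, hJJ]
    simp [add_comm]
  refine ⟨⟨hSt, hSJ⟩, fun x => ?_, fun a b h => ?_⟩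
  · calc (J *ᵥ x) ⬝ᵥ (η *ᵥ (S *ᵥ (J *ᵥ x)))
        = x ⬝ᵥ ((Jᵀ * η * J) *ᵥ (S *ᵥ x)) := by
          rw [mulVec_mulVec x S J, hSJ, ← mulVec_mulVec x J S, ← mulVec_mulVec, ← mulVec_mulVec,
            dotProduct_mulVec x, vecMul_transpose]
      _ = -(x ⬝ᵥ (η *ᵥ (S *ᵥ x))) := by rw [hηJ, neg_mulVec, dotProduct_neg]
  · have hcol (i : Fin 6) (h₀ : i ≠ 0) (h₃ : i ≠ 3) : S i 3 = 0 := by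
      simpa [h₀, h₃] using congrFun h i
    have hsum (i : Fin 6) (h₀ : i ≠ 0) (h₃ : i ≠ 3) : (η * S) 3 i + (η * S) i 3 = 0 := by
      have hrow : S 3 i = 0 := by rw [← hSt, transpose_apply, hcol i h₀ h₃]
      rw [hη, diagonal_mul, diagonal_mul, hcol i h₀ h₃, hrow, mul_zero, mul_zero, add_zero]
    exact ⟨hsum 1 (by decide) (by decide), hsum 2 (by decide) (by decide),
      hsum 4 (by decide) (by decide), hsum 5 (by decide) (by decide)⟩
end

section
/- Let R be a curvature-like tensor on ℝ⁴ satisfying the first Bianchi identity, let M(R) be its curvature-operator matrix, let ε₄ := ![−1,−1,1,1] and h := Matrix.diagonal ![−1,−1,1,1], and let H be the split-signature Hodge star matrix. Then M(R)·H = H·M(R) if and only if there exists f : ℝ such that for all j l : Fin 4, Σ_{i : Fin 4} (ε₄ i) · R i j l i = f · (h j l). -/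
open Matrix

/-- Theorem 4.4 (thm:sech), first equivalence: the curvature-operator matrix of a
curvature-like tensor `R` satisfying the first Bianchi identity commutes with the
split-signature Hodge star `H` iff `tr_h(Rm) = f·h` for some `f : ℝ`, where
`h = diag(-1,-1,1,1)` and `tr_h(Rm) j l = ∑ i, ε₄ i · R i j l i`. -/
theorem stmt_15
    (R : Fin 4 → Fin 4 → Fin 4 → Fin 4 → ℝ)
    (hR1 : ∀ a b c d, R a b c d = -R b a c d)
    (hR2 : ∀ a b c d, R a b c d = -R a b d c)
    (hR3 : ∀ a b c d, R a b c d = R c d a b)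
    (hBianchi : ∀ a b c d, R a b c d + R b c a d + R c a b d = 0)
    (pairs : Fin 6 → Fin 4 × Fin 4)
    (hpairs : pairs = ![(0,1), (0,2), (0,3), (2,3), (3,1), (1,2)])
    (MR : Matrix (Fin 6) (Fin 6) ℝ)
    (hMR : ∀ p q, MR p q = -R (pairs p).1 (pairs p).2 (pairs q).1 (pairs q).2)
    (H : Matrix (Fin 6) (Fin 6) ℝ)
    (hH : H = !![0,0,0,1,0,0; 0,0,0,0,-1,0; 0,0,0,0,0,-1;
                 1,0,0,0,0,0; 0,-1,0,0,0,0; 0,0,-1,0,0,0])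
    (ε₄ : Fin 4 → ℝ) (hε₄ : ε₄ = ![-1, -1, 1, 1])
    (h : Matrix (Fin 4) (Fin 4) ℝ) (hh : h = Matrix.diagonal ![-1, -1, 1, 1]) :
    MR * H = H * MR ↔ ∃ f : ℝ, ∀ j l : Fin 4, ∑ i, ε₄ i * R i j l i = f * h j l := by
  have hz (a c d) : R a a c d = 0 := by linarith [hR1 a a c d]
  have hz' (a b c) : R a b c c = 0 := by linarith [hR2 a b c c]
  have e10 := hR1 1 0
  have e20 := hR1 2 0
  have e30 := hR1 3 0
  have e21 := hR1 2 1
  have e31 := hR1 3 1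
  have e32 := hR1 3 2
  have e10' := fun a b => hR2 a b 1 0
  have e20' := fun a b => hR2 a b 2 0
  have e30' := fun a b => hR2 a b 3 0
  have e21' := fun a b => hR2 a b 2 1
  have e31' := fun a b => hR2 a b 3 1
  have e32' := fun a b => hR2 a b 3 2
  have s1 := hR3 0 2 0 1
  have s2 := hR3 0 3 0 1
  have s3 := hR3 1 2 0 1
  have s4 := hR3 1 3 0 1
  have s5 := hR3 2 3 0 1
  have s6 := hR3 0 3 0 2
  have s7 := hR3 1 2 0 2
  have s8 := hR3 1 3 0 2
  have s9 := hR3 2 3 0 2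
  have s10 := hR3 1 2 0 3
  have s11 := hR3 1 3 0 3
  have s12 := hR3 2 3 0 3
  have s13 := hR3 1 3 1 2
  have s14 := hR3 2 3 1 2
  have s15 := hR3 2 3 1 3
  clear hR1 hR2 hR3 hBianchi
  rw [← Matrix.ext_iff]
  subst hH hε₄ hh hpairs
  simp only [Matrix.mul_apply, hMR, Fin.sum_univ_six, Fin.sum_univ_four, Fin.forall_fin_succ]
  simp [hz, hz', e10, e20, e30, e21, e31, e32, e10', e20', e30', e21', e31',
    e32', s1, s2, s3, s4, s5, s6, s7, s8, s9, s10, s11, s12, s13, s14, s15]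
  constructor <;> intro hc <;> casesm* _ ∧ _ <;> (repeat' apply And.intro) <;> linarith
end

section
/- Let R be a curvature-like tensor on ℝ⁴ satisfying the first Bianchi identity, let M := M(R) be its curvature-operator matrix, and let H be the split-signature Hodge star matrix. Then M·H = H·M if and only if for every x : Fin 6 → ℝ with x 1 · x 4 + x 2 · x 5 + x 3 · x 6 = 0 (entries written 1-based; the Plücker condition that x is a decomposable bivector), one has (H *ᵥ x) ⬝ᵥ (M *ᵥ (H *ᵥ x)) = x ⬝ᵥ (M *ᵥ x). -/
open Matrix

/-- A symmetric matrix vanishes at `(p, q)` when its quadratic form vanishes at `e_p`, `e_q`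
and `e_p + e_q`. -/
theorem Matrix.IsSymm.apply_eq_zero_of_quadratic {n : Type*} [Fintype n] [DecidableEq n]
    {N : Matrix n n ℝ} (hN : N.IsSymm) {p q : n}
    (hp : Pi.single p 1 ⬝ᵥ (N *ᵥ Pi.single p 1) = 0)
    (hq : Pi.single q 1 ⬝ᵥ (N *ᵥ Pi.single q 1) = 0)
    (hpq : (Pi.single p 1 + Pi.single q 1) ⬝ᵥ (N *ᵥ (Pi.single p 1 + Pi.single q 1)) = 0) :
    N p q = 0 := by
  have hs := hN.apply p q
  simp only [mulVec_add, add_dotProduct, dotProduct_add, mulVec_single_one,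
    single_one_dotProduct, col_apply] at hp hq hpq
  linarith

/-- A symmetric bilinear form on bivectors whose quadratic form vanishes on decomposable
bivectors, and which vanishes on the pairs `(p, p + 3)` of dual basis bivectors, is zero. -/
theorem Matrix.IsSymm.eq_zero_of_decomposable {N : Matrix (Fin 6) (Fin 6) ℝ} (hN : N.IsSymm)
    (hdual : ∀ p, N p (p + 3) = 0)
    (hQ : ∀ x : Fin 6 → ℝ, x 0 * x 3 + x 1 * x 4 + x 2 * x 5 = 0 → x ⬝ᵥ (N *ᵥ x) = 0) :
    N = 0 := by
  have hsingle (p : Fin 6) : Pi.single p 1 ⬝ᵥ (N *ᵥ Pi.single p 1) = 0 := by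
    apply hQ
    fin_cases p <;> simp
  ext p q
  by_cases h : q = p + 3
  · simpa [h] using hdual p
  · refine hN.apply_eq_zero_of_quadratic (hsingle p) (hsingle q) (hQ _ ?_)
    fin_cases p <;> fin_cases q <;> first | exact absurd rfl h | simp

/-- Theorem 4.4 (thm:sech), second equivalence: the curvature-operator matrix of a
curvature-like tensor `R` satisfying the first Bianchi identity commutes with the
split-signature Hodge star `H` iff `sec_g(H·x) = sec_g(x)` for every decomposable bivector
`x` (Plücker condition `x₁x₄ + x₂x₅ + x₃x₆ = 0`, written 0-based). -/
theorem stmt_16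
    (R : Fin 4 → Fin 4 → Fin 4 → Fin 4 → ℝ)
    (hR1 : ∀ a b c d, R a b c d = -R b a c d)
    (hR2 : ∀ a b c d, R a b c d = -R a b d c)
    (hR3 : ∀ a b c d, R a b c d = R c d a b)
    (hBianchi : ∀ a b c d, R a b c d + R b c a d + R c a b d = 0)
    (pairs : Fin 6 → Fin 4 × Fin 4)
    (hpairs : pairs = ![(0,1), (0,2), (0,3), (2,3), (3,1), (1,2)])
    (M : Matrix (Fin 6) (Fin 6) ℝ)
    (hM : ∀ p q, M p q = -R (pairs p).1 (pairs p).2 (pairs q).1 (pairs q).2)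
    (H : Matrix (Fin 6) (Fin 6) ℝ)
    (hH : H = !![0,0,0,1,0,0; 0,0,0,0,-1,0; 0,0,0,0,0,-1;
                 1,0,0,0,0,0; 0,-1,0,0,0,0; 0,0,-1,0,0,0]) :
    M * H = H * M ↔
      ∀ x : Fin 6 → ℝ, x 0 * x 3 + x 1 * x 4 + x 2 * x 5 = 0 →
        (H *ᵥ x) ⬝ᵥ (M *ᵥ (H *ᵥ x)) = x ⬝ᵥ (M *ᵥ x) := by
  have hMs : M.IsSymm := IsSymm.ext fun p q => by rw [hM, hM, hR3]
  have hHs : Hᵀ = H := by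
    subst hH; ext p q; fin_cases p <;> fin_cases q <;> rfl
  have hHH : H * H = 1 := by
    subst hH; ext p q; fin_cases p <;> fin_cases q <;> simp [mul_apply, Fin.sum_univ_succ]
  have hform (x : Fin 6 → ℝ) :
      (H *ᵥ x) ⬝ᵥ (M *ᵥ (H *ᵥ x)) = x ⬝ᵥ ((H * M * H) *ᵥ x) := by
    rw [← mulVec_mulVec, ← mulVec_mulVec, dotProduct_mulVec x H, ← mulVec_transpose, hHs]
  constructor
  · intro hcomm x _
    rw [hform, ← hcomm, mul_assoc, hHH, mul_one]
  · intro hsec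
    have hzero : H * M * H - M = 0 := by
      refine IsSymm.eq_zero_of_decomposable ?_ (fun p => ?_) fun x hx => ?_
      · rw [IsSymm, transpose_sub, transpose_mul, transpose_mul, hHs, hMs.eq, mul_assoc]
      · have hs := hMs.apply
        subst hH
        simp only [Matrix.sub_apply, mul_apply, sub_eq_zero]
        fin_cases p <;> simp [Fin.sum_univ_succ] <;> exact hs _ _
      · rw [sub_mulVec, dotProduct_sub, ← hform, hsec x hx, sub_self]
    calc M * H = H * M * H * H := by rw [sub_eq_zero.mp hzero]
      _ = H * M := by rw [mul_assoc, hHH, mul_one]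
end

section
/- Let R be a curvature-like tensor on ℝ⁴ satisfying the first Bianchi identity, and let M̂(R) be the 6×6 real matrix with entries M̂(R) p q = −R i_p j_p i_q j_q, where the index pairs (i_p, j_p) run through (1,2),(1,3),(1,4),(3,4),(4,2),(2,3). Then M̂(R) commutes with ✶ := Matrix.fromBlocks 0 1 1 0 (3×3 blocks) if and only if there exists f : ℝ such that for all j l : Fin 4, Σ_{i : Fin 4} R i j l i = f · (if j = l then 1 else 0). -/
open Matrix

/-- In the blocks of size three, the Hodge star is the permutation matrix of the shift `q ↦ q + 3`. -/
theorem hodgeStar_apply (p q : Fin 6) :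
    (Matrix.fromBlocks (0 : Matrix (Fin 3) (Fin 3) ℝ) 1 1 0).submatrix
      (@finSumFinEquiv 3 3).symm (@finSumFinEquiv 3 3).symm p q = if p = q + 3 then 1 else 0 := by
  obtain ⟨p, rfl⟩ := (@finSumFinEquiv 3 3).surjective p
  obtain ⟨q, rfl⟩ := (@finSumFinEquiv 3 3).surjective q
  simp only [Matrix.submatrix_apply, Equiv.symm_apply_apply]
  rcases p with p | p <;> rcases q with q | q <;>
    fin_cases p <;> fin_cases q <;> simp <;> decide

/-- A matrix commutes with the Hodge star iff shifting the column index by three has the same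
effect as shifting the row index by three. -/
theorem commute_hodgeStar_iff (A S : Matrix (Fin 6) (Fin 6) ℝ)
    (hS : ∀ p q, S p q = if p = q + 3 then 1 else 0) :
    A * S = S * A ↔ ∀ p q, A p (q + 3) = A (p + 3) q := by
  have hS' : ∀ p q, S p q = if q = p + 3 then 1 else 0 := by
    intro p q
    have : p = q + 3 ↔ q = p + 3 := by revert p q; decide
    simp only [hS, this]
  have hr : ∀ p q, (A * S) p q = A p (q + 3) := by
    intro p q
    simp [Matrix.mul_apply, hS]
  have hl : ∀ p q, (S * A) p q = A (p + 3) q := by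
    intro p q
    simp [Matrix.mul_apply, hS']
  simp only [← Matrix.ext_iff, hr, hl]

/-- A tensor antisymmetric in its first two indices vanishes when they coincide. -/
theorem antisymm_left_self {R : Fin 4 → Fin 4 → Fin 4 → Fin 4 → ℝ}
    (hR : ∀ a b c d, R a b c d = -R b a c d) (a c d : Fin 4) : R a a c d = 0 := by
  linarith [hR a a c d]

/-- A tensor antisymmetric in its last two indices vanishes when they coincide. -/
theorem antisymm_right_self {R : Fin 4 → Fin 4 → Fin 4 → Fin 4 → ℝ}
    (hR : ∀ a b c d, R a b c d = -R a b d c) (a b c : Fin 4) : R a b c c = 0 := by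
  linarith [hR a b c c]

/-- Theorem 5.2 (thm:last), equivalence: the `h`-self-adjoint curvature-operator matrix
`M̂(R)` of a curvature-like tensor `R` satisfying the first Bianchi identity commutes with
the Riemannian Hodge star `✶ = fromBlocks 0 1 1 0` iff `tr_h(Rm) = f·h`, i.e.
`∑ i, R i j l i = f · δ_{jl}` for some `f : ℝ`. -/
theorem stmt_17
    (R : Fin 4 → Fin 4 → Fin 4 → Fin 4 → ℝ)
    (hR1 : ∀ a b c d, R a b c d = -R b a c d)
    (hR2 : ∀ a b c d, R a b c d = -R a b d c)
    (hR3 : ∀ a b c d, R a b c d = R c d a b)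
    (hBianchi : ∀ a b c d, R a b c d + R b c a d + R c a b d = 0)
    (pairs : Fin 6 → Fin 4 × Fin 4)
    (hpairs : pairs = ![(0,1), (0,2), (0,3), (2,3), (3,1), (1,2)])
    (MR : Matrix (Fin 6) (Fin 6) ℝ)
    (hMR : ∀ p q, MR p q = -R (pairs p).1 (pairs p).2 (pairs q).1 (pairs q).2)
    (star : Matrix (Fin 6) (Fin 6) ℝ)
    (hstar : star = (Matrix.fromBlocks (0 : Matrix (Fin 3) (Fin 3) ℝ) 1 1 0).submatrix
      (@finSumFinEquiv 3 3).symm (@finSumFinEquiv 3 3).symm) :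
    MR * star = star * MR ↔
      ∃ f : ℝ, ∀ j l : Fin 4, ∑ i, R i j l i = f * (if j = l then 1 else 0) := by
  rw [commute_hodgeStar_iff MR star (fun p q => by rw [hstar, hodgeStar_apply])]
  simp only [hMR, hpairs]
  have shift : (0 + 3 : Fin 6) = 3 ∧ (1 + 3 : Fin 6) = 4 ∧ (2 + 3 : Fin 6) = 5 ∧
      (3 + 3 : Fin 6) = 0 ∧ (4 + 3 : Fin 6) = 1 ∧ (5 + 3 : Fin 6) = 2 := by decide
  obtain ⟨s0, s1, s2, s3, s4, s5⟩ := shift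
  simp only [Fin.forall_fin_succ, Fin.sum_univ_four, Fin.reduceSucc, IsEmpty.forall_iff, and_true,
    Fin.succ_zero_eq_one, Fin.succ_one_eq_two, s0, s1, s2, s3, s4, s5, Matrix.cons_val,
    Fin.reduceEq, if_true, if_false, mul_one, mul_zero,
    antisymm_left_self hR1, antisymm_right_self hR2,
    hR1 1 0, hR1 2 0, hR1 3 0, hR1 2 1, hR1 3 1, hR1 3 2,
    hR2 _ _ 1 0, hR2 _ _ 2 0, hR2 _ _ 3 0, hR2 _ _ 2 1, hR2 _ _ 3 1, hR2 _ _ 3 2,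
    hR3 0 2 0 1, hR3 0 3 0 1, hR3 0 3 0 2, hR3 1 2 0 1, hR3 1 2 0 2,
    hR3 1 2 0 3, hR3 1 3 0 1, hR3 1 3 0 2, hR3 1 3 0 3, hR3 1 3 1 2,
    hR3 2 3 0 1, hR3 2 3 0 2, hR3 2 3 0 3, hR3 2 3 1 2, hR3 2 3 1 3]
  constructor
  · intro h
    refine ⟨-(R 0 1 0 1 + R 0 2 0 2 + R 0 3 0 3), ?_⟩
    casesm* _ ∧ _
    refine ⟨⟨?_, ?_, ?_, ?_⟩, ⟨?_, ?_, ?_, ?_⟩, ⟨?_, ?_, ?_, ?_⟩, ?_, ?_, ?_, ?_⟩ <;> linarith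
  · rintro ⟨f, h⟩
    casesm* _ ∧ _
    refine ⟨⟨trivial, ?_, ?_, ?_, ?_, ?_⟩, ⟨?_, trivial, ?_, ?_, ?_, ?_⟩,
      ⟨?_, ?_, trivial, ?_, ?_, ?_⟩, ⟨?_, ?_, ?_, trivial, ?_, ?_⟩,
      ⟨?_, ?_, ?_, ?_, trivial, ?_⟩, ?_, ?_, ?_, ?_, ?_⟩ <;> linarith
end

section
/- Let M be a symmetric 6×6 real matrix commuting with ✶ := Matrix.fromBlocks 0 1 1 0 (3×3 blocks, 1 the identity). Then there exist vectors P₁, P₂, P₃ : Fin 6 → ℝ and real numbers λ₁, λ₂, λ₃, μ₁, μ₂, μ₃ such that the six vectors P₁, P₂, P₃, ✶*ᵥP₁, ✶*ᵥP₂, ✶*ᵥP₃ form an orthonormal basis of ℝ⁶ with respect to the standard Euclidean inner product, and M *ᵥ Pᵢ = λᵢ • Pᵢ + μᵢ • (✶ *ᵥ Pᵢ) for i = 1, 2, 3. -/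
open Matrix

/-- The spectral theorem for a real symmetric matrix, phrased with the dot product. -/
theorem Matrix.IsSymm.exists_orthonormal_eigenvectors {n : Type*} [Fintype n] [DecidableEq n]
    {A : Matrix n n ℝ} (hA : A.IsSymm) :
    ∃ (u : n → n → ℝ) (a : n → ℝ),
      (∀ i j, u i ⬝ᵥ u j = if i = j then 1 else 0) ∧ ∀ i, A *ᵥ u i = a i • u i := by
  have hH : A.IsHermitian := by
    rw [Matrix.IsHermitian, Matrix.conjTranspose_eq_transpose_of_trivial]
    exact hA
  refine ⟨fun i => (hH.eigenvectorBasis i).ofLp, hH.eigenvalues, fun i j => ?_, fun i => ?_⟩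
  · have h := orthonormal_iff_ite.mp hH.eigenvectorBasis.orthonormal j i
    rw [EuclideanSpace.inner_eq_star_dotProduct] at h
    simpa [eq_comm] using h
  · exact hH.mulVec_eigenvectorBasis i

/-- Normal form of a symmetric block matrix commuting with the block swap. -/
theorem Matrix.exists_orthonormal_normalForm_of_commute_swap
    {n : Type*} [Fintype n] [DecidableEq n] {N : Matrix (n ⊕ n) (n ⊕ n) ℝ} (hN : N.IsSymm)
    (hcomm : N * fromBlocks 0 1 1 0 = fromBlocks 0 1 1 0 * N) :
    ∃ (P : n → n ⊕ n → ℝ) (l m : n → ℝ),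
      (∀ i j, P i ⬝ᵥ P j = if i = j then 1 else 0) ∧
      (∀ i j, P i ⬝ᵥ (fromBlocks 0 1 1 0 *ᵥ P j) = 0) ∧
      ∀ i, N *ᵥ P i = l i • P i + m i • (fromBlocks 0 1 1 0 *ᵥ P i) := by
  obtain ⟨A, B, C, D, rfl⟩ : ∃ A B C D, N = fromBlocks A B C D :=
    ⟨_, _, _, _, (fromBlocks_toBlocks N).symm⟩
  simp only [fromBlocks_multiply, fromBlocks_inj, mul_zero, mul_one, zero_mul, one_mul,
    zero_add, add_zero] at hcomm
  obtain ⟨rfl, rfl, -, -⟩ := hcomm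
  rw [isSymm_fromBlocks_iff] at hN
  obtain ⟨hA, hB : B.IsSymm, -, -⟩ := hN
  obtain ⟨u, a, hu, hua⟩ := (hA.add hB).exists_orthonormal_eigenvectors
  obtain ⟨v, b, hv, hvb⟩ := (hA.sub hB).exists_orthonormal_eigenvectors
  refine ⟨fun i => Sum.elim ((1 / 2 : ℝ) • (u i + v i)) ((1 / 2 : ℝ) • (u i - v i)),
    fun i => (a i + b i) / 2, fun i => (a i - b i) / 2, fun i j => ?_, fun i j => ?_,
    fun i => ?_⟩
  · have h₁ := hu i j
    have h₂ := hv i j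
    simp only [sumElim_dotProduct_sumElim, smul_dotProduct, dotProduct_smul, add_dotProduct,
      dotProduct_add, sub_dotProduct, dotProduct_sub, smul_eq_mul, h₁, h₂]
    ring
  · have h₁ := hu i j
    have h₂ := hv i j
    simp only [fromBlocks_mulVec, Sum.elim_comp_inl, Sum.elim_comp_inr, zero_mulVec, one_mulVec,
      zero_add, add_zero, sumElim_dotProduct_sumElim, smul_dotProduct, dotProduct_smul,
      add_dotProduct, dotProduct_add, sub_dotProduct, dotProduct_sub, smul_eq_mul, h₁, h₂]
    ring
  · have h₁ := hua i
    have h₂ := hvb i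
    rw [add_mulVec] at h₁
    rw [sub_mulVec] at h₂
    simp only [fromBlocks_mulVec, Sum.elim_comp_inl, Sum.elim_comp_inr, zero_mulVec, one_mulVec,
      add_zero, mulVec_smul, mulVec_add, mulVec_sub]
    ext (k | k) <;>
    · have h₃ := congrFun h₁ k
      have h₄ := congrFun h₂ k
      simp only [Pi.add_apply, Pi.sub_apply, Pi.zero_apply, Pi.smul_apply, smul_eq_mul,
        Sum.elim_inl, Sum.elim_inr] at h₃ h₄ ⊢
      linarith

/-- Theorem 5.2 (thm:last), normal form (following Singer–Thorpe): a symmetric 6×6 real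
matrix `M` commuting with the Riemannian Hodge star `✶ = fromBlocks 0 1 1 0` admits planes
`P₁, P₂, P₃` such that `P₁, P₂, P₃, ✶P₁, ✶P₂, ✶P₃` form an orthonormal basis of ℝ⁶ (for the
standard Euclidean dot product) and `M Pᵢ = λᵢ Pᵢ + μᵢ (✶Pᵢ)`. -/
theorem stmt_18 (M : Matrix (Fin 6) (Fin 6) ℝ) (hsym : Mᵀ = M)
    (star : Matrix (Fin 6) (Fin 6) ℝ)
    (hstar : star = (Matrix.fromBlocks (0 : Matrix (Fin 3) (Fin 3) ℝ) 1 1 0).submatrix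
      (@finSumFinEquiv 3 3).symm (@finSumFinEquiv 3 3).symm)
    (hcomm : M * star = star * M) :
    ∃ (P₁ P₂ P₃ : Fin 6 → ℝ) (l1 l2 l3 m1 m2 m3 : ℝ),
      (∀ i j : Fin 6,
        (![P₁, P₂, P₃, star *ᵥ P₁, star *ᵥ P₂, star *ᵥ P₃] i) ⬝ᵥ
          (![P₁, P₂, P₃, star *ᵥ P₁, star *ᵥ P₂, star *ᵥ P₃] j) =
        if i = j then 1 else 0) ∧
      M *ᵥ P₁ = l1 • P₁ + m1 • (star *ᵥ P₁) ∧
      M *ᵥ P₂ = l2 • P₂ + m2 • (star *ᵥ P₂) ∧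
      M *ᵥ P₃ = l3 • P₃ + m3 • (star *ᵥ P₃) := by
  set e := @finSumFinEquiv 3 3
  set S : Matrix (Fin 3 ⊕ Fin 3) (Fin 3 ⊕ Fin 3) ℝ := fromBlocks 0 1 1 0 with hS
  have hstar' : star.submatrix e e = S := by simp [hstar]
  have hN : (M.submatrix e e).IsSymm := by
    rw [Matrix.IsSymm, transpose_submatrix, hsym]
  have hcomm' : M.submatrix e e * S = S * M.submatrix e e := by
    rw [← hstar', submatrix_mul_equiv, submatrix_mul_equiv, hcomm]
  obtain ⟨P, l, m, hPP, hPS, hM⟩ := exists_orthonormal_normalForm_of_commute_swap hN hcomm'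
  rw [← hS] at hPS
  have hmul (T : Matrix (Fin 6) (Fin 6) ℝ) (w : Fin 3 ⊕ Fin 3 → ℝ) :
      T *ᵥ (w ∘ e.symm) = (T.submatrix e e *ᵥ w) ∘ e.symm := by
    rw [submatrix_mulVec_equiv]
    ext k
    simp
  have hdot (v w : Fin 3 ⊕ Fin 3 → ℝ) : (v ∘ e.symm) ⬝ᵥ (w ∘ e.symm) = v ⬝ᵥ w :=
    comp_equiv_dotProduct_comp_equiv v w e.symm
  have hSP (i j : Fin 3) : (S *ᵥ P i) ⬝ᵥ P j = 0 := by
    rw [dotProduct_comm, hPS]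
  have hSS (i j : Fin 3) : (S *ᵥ P i) ⬝ᵥ (S *ᵥ P j) = if i = j then 1 else 0 := by
    have hT : Sᵀ = S := by simp [hS, fromBlocks_transpose]
    have hsq : S * S = 1 := by simp [hS, fromBlocks_multiply]
    rw [dotProduct_mulVec, ← mulVec_transpose, hT, mulVec_mulVec, hsq, one_mulVec, hPP]
  have hPM (i : Fin 3) : M *ᵥ (P i ∘ e.symm) =
      l i • (P i ∘ e.symm) + m i • (star *ᵥ (P i ∘ e.symm)) := by
    rw [hmul, hmul, hM, hstar']
    rfl
  refine ⟨P 0 ∘ e.symm, P 1 ∘ e.symm, P 2 ∘ e.symm, l 0, l 1, l 2, m 0, m 1, m 2,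
    fun i j => ?_, hPM 0, hPM 1, hPM 2⟩
  simp only [hmul, hstar']
  fin_cases i <;> fin_cases j <;> simp [hdot, hPP, hPS, hSP, hSS]
end
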